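/- arXiv:1612.06818 — 2 statements merged into one kernel-verified Lean document; each statement's English description precedes it below -/
import Mathlib

section
/- Let n ≥ 3, let a₁ < a₂ < … < aₙ be real numbers, and let α₁, …, αₙ ∈ (0,1) satisfy Σⱼ αⱼ = n − 2. Set b(z) = Σⱼ (αⱼ − 1)/(z − aⱼ) and r₀ the unique positive root of (1/2)[Σⱼ(αⱼ−1)² + Σ_{j<l}(αⱼ−1)(α_l−1)]·r² − (Σⱼ(αⱼ−1))·r − 2 = 0. Then for every r with 0 < r < r₀ there exists a holomorphic function w on the upper half-plane U = {z ∈ ℂ : Im z > 0} with nonvanishing derivative that is injective on U and whose Schwarzian derivative satisfies S_w(z) = r·b′(z) − (r²/2)·b(z)² for all z ∈ U. -/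
/-- The Schwarzian derivative `S_f = (f″/f′)′ − (1/2)(f″/f′)²`. -/
noncomputable def schwarzianDeriv (f : ℂ → ℂ) (z : ℂ) : ℂ :=
  deriv (fun w => deriv (deriv f) w / deriv f w) z
    - (1 / 2) * (deriv (deriv f) z / deriv f z) ^ 2

/-- The **Noshiro–Warschawski criterion** on a convex set, with a rotation factor `d`. -/
theorem injOn_of_re_mul_deriv_pos {S : Set ℂ} (hS : Convex ℝ S) {F F' : ℂ → ℂ}
    (hF : ∀ u ∈ S, HasDerivAt F (F' u) u) {d : ℂ} (hd : ∀ u ∈ S, 0 < (d * F' u).re) :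
    Set.InjOn F S := by
  intro u hu v hv huv
  by_contra hne
  have hne' : v - u ≠ 0 := sub_ne_zero.2 (Ne.symm hne)
  have hmem : ∀ t ∈ Set.Icc (0 : ℝ) 1, u + (t : ℂ) * (v - u) ∈ S := by
    intro t ht
    simpa using hS.add_smul_sub_mem hu hv ht
  have hder : ∀ t ∈ Set.Icc (0 : ℝ) 1,
      HasDerivAt (fun t : ℝ => (d * (F (u + (t : ℂ) * (v - u)) / (v - u))).re)
        (d * F' (u + (t : ℂ) * (v - u))).re t := by
    intro t ht
    have hline : HasDerivAt (fun s : ℂ => u + s * (v - u)) (v - u) (t : ℂ) := by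
      simpa using ((hasDerivAt_id (t : ℂ)).mul_const (v - u)).const_add u
    have h := (((hF _ (hmem t ht)).comp (t : ℂ) hline).div_const (v - u)).const_mul d
    rw [mul_div_cancel_right₀ _ hne'] at h
    exact h.real_of_complex
  obtain ⟨t, ht, ht0⟩ := exists_hasDerivAt_eq_zero (zero_lt_one' ℝ)
    (fun t ht => (hder t ht).continuousAt.continuousWithinAt) (by simp [huv])
    (fun t ht => hder t (Set.Ioo_subset_Icc_self ht))
  exact (hd _ (hmem t (Set.Ioo_subset_Icc_self ht))).ne' ht0

/-- In the upper half-plane, `arg (z - x)` is nondecreasing in the real number `x`. -/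
theorem arg_sub_ofReal_mono {z : ℂ} (hz : 0 < z.im) :
    Monotone fun x : ℝ => (z - (x : ℂ)).arg := by
  intro x y hxy
  by_contra! h
  have him : ∀ x : ℝ, 0 < (z - (x : ℂ)).im := by simpa using hz
  have hx := Complex.arg_lt_pi_iff.2 (Or.inr (him x).ne')
  have hy := Complex.arg_nonneg_iff.2 (him y).le
  have hs := Real.sin_pos_of_pos_of_lt_pi (sub_pos.2 h) (by linarith)
  have hx0 : 0 < ‖z - (x : ℂ)‖ := norm_pos_iff.2 fun h0 => (him x).ne' (by simp [h0])
  have hy0 : 0 < ‖z - (y : ℂ)‖ := norm_pos_iff.2 fun h0 => (him y).ne' (by simp [h0])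
  have key := mul_pos (mul_pos hx0 hy0) hs
  have e : ‖z - (x : ℂ)‖ * ‖z - (y : ℂ)‖ *
      Real.sin ((z - (x : ℂ)).arg - (z - (y : ℂ)).arg) = z.im * (x - y) := by
    rw [Real.sin_sub]
    calc _ = (‖z - (x : ℂ)‖ * Real.sin (z - (x : ℂ)).arg)
              * (‖z - (y : ℂ)‖ * Real.cos (z - (y : ℂ)).arg)
            - (‖z - (x : ℂ)‖ * Real.cos (z - (x : ℂ)).arg)
              * (‖z - (y : ℂ)‖ * Real.sin (z - (y : ℂ)).arg) := by ring
      _ = _ := by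
        simp only [Complex.norm_mul_sin_arg, Complex.norm_mul_cos_arg]
        simp
        ring
  rw [e] at key
  nlinarith

/-- A weighted median: nonnegative weights of total mass `2` admit an index `k` such that both
`{j ≤ k}` and `{k ≤ j}` have mass at least `1`. -/
theorem exists_weighted_median {ι : Type*} [Fintype ι] [LinearOrder ι] (c : ι → ℝ)
    (hsum : ∑ j, c j = 2) :
    ∃ k, 1 ≤ ∑ j with j ≤ k, c j ∧ 1 ≤ ∑ j with k ≤ j, c j := by
  have hne : (Finset.univ : Finset ι).Nonempty := by
    by_contra h
    rw [Finset.not_nonempty_iff_eq_empty] at h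
    simp [h] at hsum
  have hs : (Finset.univ.filter fun k => 1 ≤ ∑ j with j ≤ k, c j).Nonempty := by
    refine ⟨Finset.univ.max' hne, ?_⟩
    have : ∀ j, j ≤ Finset.univ.max' hne := fun j => Finset.le_max' _ _ (Finset.mem_univ j)
    simp [this, hsum]
  refine ⟨_, (Finset.mem_filter.1 (Finset.min'_mem _ hs)).2, ?_⟩
  set k := Finset.min' _ hs with hk
  have hsplit := Finset.sum_filter_add_sum_filter_not Finset.univ (fun j => j < k) c
  simp only [not_lt, hsum] at hsplit
  suffices h : ∑ j with j < k, c j ≤ 1 by linarith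
  by_contra! h
  have hne' : (Finset.univ.filter fun j => j < k).Nonempty := by
    by_contra h0
    rw [Finset.not_nonempty_iff_eq_empty] at h0
    rw [h0] at h
    norm_num at h
  set m := Finset.max' _ hne' with hm
  have hmk : m < k := (Finset.mem_filter.1 (Finset.max'_mem _ hne')).2
  have heq : (Finset.univ.filter fun j => j ≤ m) = Finset.univ.filter fun j => j < k := by
    ext j
    simp only [Finset.mem_filter, Finset.mem_univ, true_and]
    exact ⟨fun hj => hj.trans_lt hmk, fun hj => Finset.le_max' _ _ (by simpa using hj)⟩
  exact hmk.not_ge (Finset.min'_le _ _ (by simp [heq, h.le]))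

theorem weighted_median_bounds {ι : Type*} [Fintype ι] [LinearOrder ι] {c θ : ι → ℝ}
    (hc : ∀ j, 0 ≤ c j) (hsum : ∑ j, c j = 2) (hθ : Monotone θ) {M : ℝ} (h0 : ∀ j, 0 ≤ θ j)
    (hM : ∀ j, θ j ≤ M) {k : ι} (hk : 1 ≤ ∑ j with j ≤ k, c j)
    (hk' : 1 ≤ ∑ j with k ≤ j, c j) :
    -M ≤ θ k - ∑ j, c j * θ j ∧ θ k - ∑ j, c j * θ j ≤ 0 := by
  have upper : θ k ≤ ∑ j, c j * θ j :=
    calc θ k ≤ (∑ j with k ≤ j, c j) * θ k := le_mul_of_one_le_left (h0 k) hk'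
      _ = ∑ j with k ≤ j, c j * θ k := Finset.sum_mul ..
      _ ≤ ∑ j with k ≤ j, c j * θ j := Finset.sum_le_sum fun j hj =>
        mul_le_mul_of_nonneg_left (hθ (Finset.mem_filter.1 hj).2) (hc j)
      _ ≤ ∑ j, c j * θ j := Finset.sum_le_sum_of_subset_of_nonneg (Finset.filter_subset _ _)
        fun j _ _ => mul_nonneg (hc j) (h0 j)
  have lower : M - θ k ≤ ∑ j, c j * (M - θ j) :=
    calc M - θ k ≤ (∑ j with j ≤ k, c j) * (M - θ k) :=
          le_mul_of_one_le_left (sub_nonneg.2 (hM k)) hk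
      _ = ∑ j with j ≤ k, c j * (M - θ k) := Finset.sum_mul ..
      _ ≤ ∑ j with j ≤ k, c j * (M - θ j) := Finset.sum_le_sum fun j hj =>
        mul_le_mul_of_nonneg_left
          (sub_le_sub_left (hθ (Finset.mem_filter.1 hj).2) M) (hc j)
      _ ≤ ∑ j, c j * (M - θ j) := Finset.sum_le_sum_of_subset_of_nonneg (Finset.filter_subset _ _)
        fun j _ _ => mul_nonneg (hc j) (sub_nonneg.2 (hM j))
  simp only [mul_sub, Finset.sum_sub_distrib, ← Finset.sum_mul, hsum] at lower
  constructor <;> linarith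

/-- The open sector `0 < arg u < π q`, as an intersection of two half-planes. -/
def openSector (q : ℝ) : Set ℂ :=
  {u | 0 < u.im ∧ u.im * Real.cos (Real.pi * q) - u.re * Real.sin (Real.pi * q) < 0}

theorem convex_openSector (q : ℝ) : Convex ℝ (openSector q) := by
  intro u hu v hv s t hs ht hst
  obtain ⟨hu1, hu2⟩ := hu
  obtain ⟨hv1, hv2⟩ := hv
  constructor
  · simp only [Complex.add_im, Complex.real_smul, Complex.im_ofReal_mul]
    rcases hs.eq_or_lt with rfl | hs
    · obtain rfl : t = 1 := by linarith
      simpa using hv1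
    · have := mul_pos hs hu1
      have := mul_nonneg ht hv1.le
      linarith
  · simp only [Complex.add_im, Complex.add_re, Complex.real_smul, Complex.im_ofReal_mul,
      Complex.re_ofReal_mul]
    rcases hs.eq_or_lt with rfl | hs
    · obtain rfl : t = 1 := by linarith
      simpa using hv2
    · have := mul_neg_of_pos_of_neg hs hu2
      have := mul_nonpos_of_nonneg_of_nonpos ht hv2.le
      nlinarith

theorem mem_openSector_iff {q : ℝ} (hq0 : 0 < q) (hq1 : q < 1) {u : ℂ} :
    u ∈ openSector q ↔ u ≠ 0 ∧ 0 < u.arg ∧ u.arg < Real.pi * q := by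
  have hπ := Real.pi_pos
  have hπq : Real.pi * q < Real.pi := by nlinarith
  have e : u.im * Real.cos (Real.pi * q) - u.re * Real.sin (Real.pi * q)
      = ‖u‖ * Real.sin (u.arg - Real.pi * q) := by
    rw [Real.sin_sub, mul_sub, ← mul_assoc, ← mul_assoc, Complex.norm_mul_sin_arg,
      Complex.norm_mul_cos_arg]
  constructor
  · rintro ⟨h1, h2⟩
    have hu : u ≠ 0 := fun h => by simp [h] at h1
    have harg : 0 < u.arg := by
      refine (Complex.arg_nonneg_iff.2 h1.le).lt_of_ne' fun h => ?_
      exact h1.ne' (Complex.arg_eq_zero_iff.1 h).2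
    refine ⟨hu, harg, ?_⟩
    by_contra! h
    rw [e] at h2
    have := Real.sin_nonneg_of_nonneg_of_le_pi (sub_nonneg.2 h)
      (by linarith [Complex.arg_le_pi u, mul_pos hπ hq0])
    exact h2.not_ge (mul_nonneg (norm_nonneg _) this)
  · rintro ⟨hu, h1, h2⟩
    have hn := norm_pos_iff.2 hu
    constructor
    · rw [← Complex.norm_mul_sin_arg]
      exact mul_pos hn (Real.sin_pos_of_pos_of_lt_pi h1 (by linarith))
    · rw [e]
      exact mul_neg_of_pos_of_neg hn (Real.sin_neg_of_neg_of_neg_pi_lt (by linarith) (by linarith))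

theorem sub_ofReal_mem_slitPlane {z : ℂ} (hz : 0 < z.im) (x : ℝ) :
    z - (x : ℂ) ∈ Complex.slitPlane :=
  Complex.mem_slitPlane_iff.2 (Or.inr (by simpa using hz.ne'))

theorem arg_pos_of_im_pos {z : ℂ} (hz : 0 < z.im) : 0 < z.arg :=
  (Complex.arg_nonneg_iff.2 hz.le).lt_of_ne' fun h => hz.ne' (Complex.arg_eq_zero_iff.1 h).2

/-- A function on the upper half-plane with derivative `∏ (z - aⱼ) ^ (-r cⱼ)`, where `0 < r < 1`,
`cⱼ ≥ 0` and `∑ cⱼ = 2`, is injective: it is close-to-convex with respect to the sector map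
`z ↦ (z - aₖ) ^ (1 - r)`, with `k` a weighted median of the `cⱼ`. -/
theorem injOn_of_hasDerivAt_exp_sum_log {ι : Type*} [Fintype ι] [LinearOrder ι] {a c : ι → ℝ}
    (ha : Monotone a) (hc : ∀ j, 0 ≤ c j) (hsum : ∑ j, c j = 2) {r : ℝ} (hr0 : 0 < r)
    (hr1 : r < 1) {f : ℂ → ℂ}
    (hf : ∀ z : ℂ, 0 < z.im →
      HasDerivAt f (Complex.exp (-r * ∑ j, (c j : ℂ) * Complex.log (z - a j))) z) :
    Set.InjOn f {z : ℂ | 0 < z.im} := by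
  obtain ⟨k, hk, hk'⟩ := exists_weighted_median c hsum
  have hπ := Real.pi_pos
  set q : ℝ := 1 - r with hq
  have hq0 : 0 < q := by linarith
  have hq1 : q < 1 := by linarith
  have hqC : (q : ℂ) ≠ 0 := by exact_mod_cast hq0.ne'
  set K : ℂ → ℂ := fun u => a k + Complex.exp (Complex.log u / q) with hK
  have him : ∀ u : ℂ, (Complex.log u / q).im = u.arg / q := fun u => by
    rw [Complex.div_ofReal_im, Complex.log_im]
  have hargq : ∀ u ∈ openSector q, 0 < u.arg / q ∧ u.arg / q < Real.pi := fun u hu => by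
    obtain ⟨-, h1, h2⟩ := (mem_openSector_iff hq0 hq1).1 hu
    exact ⟨div_pos h1 hq0, (div_lt_iff₀ hq0).2 h2⟩
  have hKU : ∀ u ∈ openSector q, 0 < (K u).im := fun u hu => by
    have := hargq u hu
    simp only [hK, Complex.add_im, Complex.ofReal_im, zero_add, Complex.exp_im, him]
    exact mul_pos (Real.exp_pos _) (Real.sin_pos_of_pos_of_lt_pi this.1 this.2)
  have hlogK : ∀ u ∈ openSector q, Complex.log (K u - a k) = Complex.log u / q := fun u hu => by
    have := hargq u hu
    simp only [hK, add_sub_cancel_left]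
    exact Complex.log_exp (by rw [him]; linarith) (by rw [him]; linarith)
  have hF : ∀ u ∈ openSector q, HasDerivAt (f ∘ K)
      ((1 / q : ℝ) * Complex.exp (r * Complex.log (K u - a k)
        + -r * ∑ j, (c j : ℂ) * Complex.log (K u - a j))) u := fun u hu => by
    have hu0 := ((mem_openSector_iff hq0 hq1).1 hu).1
    have hus : u ∈ Complex.slitPlane := Complex.mem_slitPlane_iff.2 (Or.inr hu.1.ne')
    have hKd : HasDerivAt K (Complex.exp (Complex.log u / q) * (u⁻¹ / q)) u :=
      (((Complex.hasDerivAt_log hus).div_const (q : ℂ)).cexp).const_add _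
    refine ((hf _ (hKU u hu)).comp u hKd).congr_deriv ?_
    have hsplit : Complex.exp (Complex.log u / q)
        = Complex.exp (r * (Complex.log u / q)) * u := by
      nth_rewrite 3 [← Complex.exp_log hu0]
      rw [← Complex.exp_add]
      congr 1
      field_simp
      rw [hq]
      push_cast
      ring
    rw [Complex.exp_add, hlogK u hu, hsplit]
    push_cast
    field_simp
  have hpos : ∀ u ∈ openSector q, 0 < (Complex.exp ((Real.pi * r / 2 : ℝ) * Complex.I) *
      ((1 / q : ℝ) * Complex.exp (r * Complex.log (K u - a k)
        + -r * ∑ j, (c j : ℂ) * Complex.log (K u - a j)))).re := fun u hu => by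
    have hz := hKU u hu
    obtain ⟨h1, h2⟩ := weighted_median_bounds hc hsum
      (fun i j hij => arg_sub_ofReal_mono hz (ha hij))
      (fun j => Complex.arg_nonneg_iff.2 (by simpa using hz.le))
      (fun j => Complex.arg_le_pi (K u - a j)) hk hk'
    rw [mul_left_comm, Complex.re_ofReal_mul, ← Complex.exp_add, Complex.exp_re]
    refine mul_pos (one_div_pos.2 hq0) (mul_pos (Real.exp_pos _) (Real.cos_pos_of_mem_Ioo ?_))
    have e : ((Real.pi * r / 2 : ℝ) * Complex.I + (r * Complex.log (K u - a k)
        + -r * ∑ j, (c j : ℂ) * Complex.log (K u - a j))).im = Real.pi * r / 2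
        + r * ((K u - a k).arg - ∑ j, c j * (K u - a j).arg) := by
      rw [← Complex.ofReal_neg]
      simp only [Complex.add_im, Complex.im_ofReal_mul, Complex.im_sum, Complex.log_im,
        Complex.I_im]
      ring
    rw [e]
    constructor <;> nlinarith
  have hinj := injOn_of_re_mul_deriv_pos (convex_openSector q) hF hpos
  set H : ℂ → ℂ := fun z => Complex.exp (q * Complex.log (z - a k)) with hH
  have hHim : ∀ z : ℂ, (q * Complex.log (z - a k)).im = q * (z - a k).arg := fun z => by
    rw [Complex.im_ofReal_mul, Complex.log_im]
  have hHarg : ∀ z : ℂ, 0 < z.im → 0 < q * (z - a k).arg ∧ q * (z - a k).arg < Real.pi * q := by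
    intro z hz
    have h1 : 0 < (z - a k).im := by simpa using hz
    have h2 := Complex.arg_lt_pi_iff.2 (Or.inr h1.ne')
    exact ⟨mul_pos hq0 (arg_pos_of_im_pos h1), by nlinarith⟩
  have hlogH : ∀ z : ℂ, 0 < z.im → Complex.log (H z) = q * Complex.log (z - a k) := by
    intro z hz
    have := hHarg z hz
    exact Complex.log_exp (by rw [hHim]; linarith) (by rw [hHim]; nlinarith)
  have hHS : ∀ z : ℂ, 0 < z.im → H z ∈ openSector q := fun z hz => by
    rw [mem_openSector_iff hq0 hq1, ← Complex.log_im, hlogH z hz, hHim]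
    exact ⟨Complex.exp_ne_zero _, hHarg z hz⟩
  have hKH : ∀ z : ℂ, 0 < z.im → K (H z) = z := fun z hz => by
    simp only [hK]
    rw [hlogH z hz, mul_div_cancel_left₀ _ hqC,
      Complex.exp_log (Complex.slitPlane_ne_zero (sub_ofReal_mem_slitPlane hz _))]
    ring
  intro z hz w hw hzw
  rw [← hKH z hz, ← hKH w hw]
  congr 1
  refine hinj (hHS z hz) (hHS w hw) ?_
  simp only [Function.comp_apply, hKH z hz, hKH w hw, hzw]

/-- For `0 < r < r₀` the Schwarzian `S_{f*,r} = r·b′ − (r²/2)·b²` is the Schwarzian of a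
function holomorphic and univalent in the upper half-plane. -/
theorem univalence_below_threshold
    (n : ℕ) (hn : 3 ≤ n) (a : Fin n → ℝ) (ha : StrictMono a)
    (α : Fin n → ℝ) (hα : ∀ j, 0 < α j ∧ α j < 1)
    (hsum : ∑ j, α j = (n : ℝ) - 2)
    (b : ℂ → ℂ)
    (hb : b = fun z : ℂ => ∑ j, ((α j : ℂ) - 1) / (z - (a j : ℂ)))
    (r₀ : ℝ) (hr₀pos : 0 < r₀)
    (hroot : (1 / 2) * (∑ j, (α j - 1) ^ 2
        + ∑ p ∈ Finset.univ.filter (fun p : Fin n × Fin n => p.1 < p.2),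
            (α p.1 - 1) * (α p.2 - 1)) * r₀ ^ 2
      - (∑ j, (α j - 1)) * r₀ - 2 = 0)
    (r : ℝ) (hr : 0 < r) (hrr₀ : r < r₀) :
    ∃ w : ℂ → ℂ,
      (∀ z ∈ {z : ℂ | 0 < z.im}, DifferentiableAt ℂ w z) ∧
      (∀ z ∈ {z : ℂ | 0 < z.im}, deriv w z ≠ 0) ∧
      Set.InjOn w {z : ℂ | 0 < z.im} ∧
      ∀ z ∈ {z : ℂ | 0 < z.im},
        schwarzianDeriv w z = (r : ℂ) * deriv b z - ((r : ℂ) ^ 2 / 2) * (b z) ^ 2 := by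
  have hc0 : ∀ j, 0 ≤ 1 - α j := fun j => by linarith [(hα j).2]
  have hcsum : ∑ j, (1 - α j) = 2 := by simp [hsum]
  have hr1 : r < 1 := by
    have hQ : 0 ≤ ∑ j, (α j - 1) ^ 2 := Finset.sum_nonneg fun j _ => sq_nonneg _
    have hP : 0 ≤ ∑ p ∈ Finset.univ.filter (fun p : Fin n × Fin n => p.1 < p.2),
        (α p.1 - 1) * (α p.2 - 1) := Finset.sum_nonneg fun p _ => by
      nlinarith [mul_nonneg (hc0 p.1) (hc0 p.2)]
    have hS : ∑ j, (α j - 1) = -2 := by simp [hsum]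
    rw [hS] at hroot
    nlinarith [mul_nonneg (add_nonneg hQ hP) (sq_nonneg r₀)]
  set U : Set ℂ := {z : ℂ | 0 < z.im} with hU
  have hUo : IsOpen U := isOpen_lt continuous_const Complex.continuous_im
  have hUc : Convex ℝ U := convex_halfSpace_im_gt 0
  set g : ℂ → ℂ := fun z =>
    Complex.exp (-r * ∑ j, ((1 - α j : ℝ) : ℂ) * Complex.log (z - a j)) with hg
  have hgd : ∀ z ∈ U, HasDerivAt g (g z * (r * b z)) z := fun z hz => by
    have hlog : ∀ j, HasDerivAt (fun z : ℂ => Complex.log (z - a j)) (1 / (z - a j)) z :=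
      fun j => ((hasDerivAt_id z).sub_const _).clog (sub_ofReal_mem_slitPlane hz (a j))
    refine (((HasDerivAt.fun_sum fun j (_ : j ∈ Finset.univ) =>
      (hlog j).const_mul ((1 - α j : ℝ) : ℂ)).const_mul (-r : ℂ)).cexp).congr_deriv ?_
    simp only [hg, hb, Finset.mul_sum]
    refine Finset.sum_congr rfl fun j _ => ?_
    push_cast
    ring
  obtain ⟨w, hw⟩ := hUc.exists_forall_hasDerivWithinAt (f := g)
    fun z hz => (hgd z hz).differentiableAt.differentiableWithinAt
  replace hw : ∀ z ∈ U, HasDerivAt w (g z) z := fun z hz =>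
    (hw z hz).hasDerivAt (hUo.mem_nhds hz)
  have hg0 : ∀ z, g z ≠ 0 := fun z => Complex.exp_ne_zero _
  have hdd : ∀ z ∈ U, deriv (deriv w) z / deriv w z = r * b z := fun z hz => by
    have h : deriv w =ᶠ[nhds z] g :=
      Filter.eventuallyEq_of_mem (hUo.mem_nhds hz) fun y hy => (hw y hy).deriv
    rw [h.deriv_eq, (hgd z hz).deriv, (hw z hz).deriv, mul_div_cancel_left₀ _ (hg0 z)]
  refine ⟨w, fun z hz => (hw z hz).differentiableAt, fun z hz => ?_,
    injOn_of_hasDerivAt_exp_sum_log ha.monotone hc0 hcsum hr hr1 hw, fun z hz => ?_⟩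
  · rw [(hw z hz).deriv]
    exact hg0 z
  · have h : (fun y => deriv (deriv w) y / deriv w y) =ᶠ[nhds z] fun y => r * b y :=
      Filter.eventuallyEq_of_mem (hUo.mem_nhds hz) hdd
    rw [schwarzianDeriv, h.deriv_eq, hdd z hz, deriv_const_mul_field]
    ring
end

section
/- Let n ≥ 3, let a₁ < a₂ < … < aₙ be real numbers, and let α₁, …, αₙ ∈ (0,1) satisfy Σⱼ αⱼ = n − 2. Set b(z) = Σⱼ (αⱼ − 1)/(z − aⱼ) and r₀ the unique positive root of (1/2)[Σⱼ(αⱼ−1)² + Σ_{j<l}(αⱼ−1)(α_l−1)]·r² − (Σⱼ(αⱼ−1))·r − 2 = 0. Then for every r with 0 < r < r₀ there exists a holomorphic function w on the upper half-plane U = {z ∈ ℂ : Im z > 0} with nonvanishing derivative that is injective on U and whose Schwarzian derivative satisfies S_w(z) = r·(r₀·b′(z) − (r₀²/2)·b(z)²) for all z ∈ U. -/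
lemma hasDerivAt_tsum_mul_pow {a : ℕ → ℂ}
    (ha : ∀ ρ : ℝ, 0 ≤ ρ → ρ < 1 → Summable fun n => ‖a n‖ * ρ ^ n) :
    (∀ ρ : ℝ, 0 ≤ ρ → ρ < 1 → Summable fun n : ℕ => ‖((n : ℂ) + 1) * a (n + 1)‖ * ρ ^ n) ∧
    ∀ z : ℂ, ‖z‖ < 1 → HasDerivAt (fun z => ∑' n, a n * z ^ n)
      (∑' n : ℕ, (((n : ℂ) + 1) * a (n + 1)) * z ^ n) z := by
  have key : ∀ ρ : ℝ, 0 ≤ ρ → ρ < 1 →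
      Summable fun n : ℕ => ‖((n : ℂ) + 1) * a (n + 1)‖ * ρ ^ n := by
    intro ρ h0 h1
    set σ := (ρ + 1) / 2 with hσ
    have hσ0 : 0 < σ := by linarith
    have hσ1 : σ < 1 := by linarith
    have hρσ : ρ / σ < 1 := by rw [div_lt_one hσ0]; linarith
    have hρσ0 : 0 ≤ ρ / σ := by positivity
    have hs : Summable fun n : ℕ => ((n : ℝ) + 1) * (ρ / σ) ^ n := by
      have h1 := summable_pow_mul_geometric_of_norm_lt_one (R := ℝ) 1 (r := ρ / σ)
        (by rwa [Real.norm_of_nonneg hρσ0])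
      have h2 := summable_geometric_of_lt_one hρσ0 hρσ
      refine (h1.add h2).congr fun n => ?_
      ring
    have hbd : ∀ n : ℕ, ((n : ℝ) + 1) * (ρ / σ) ^ n ≤ ∑' n : ℕ, ((n : ℝ) + 1) * (ρ / σ) ^ n :=
      fun n => hs.le_tsum n fun j _ => by positivity
    set C := ∑' n : ℕ, ((n : ℝ) + 1) * (ρ / σ) ^ n
    have hsh := (summable_nat_add_iff 1).2 (ha σ hσ0.le hσ1)
    refine Summable.of_nonneg_of_le (fun n => by positivity) (fun n => ?_) (hsh.mul_left (C / σ))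
    have hn : ‖(n : ℂ) + 1‖ = (n : ℝ) + 1 := by
      have := Complex.norm_natCast (n + 1)
      push_cast at this; exact this
    rw [norm_mul, hn]
    calc ((n : ℝ) + 1) * ‖a (n + 1)‖ * ρ ^ n
        = (((n : ℝ) + 1) * (ρ / σ) ^ n) * (‖a (n + 1)‖ * σ ^ n) := by
          rw [div_pow]; field_simp
      _ ≤ C * (‖a (n + 1)‖ * σ ^ n) := by gcongr; exact hbd n
      _ = C / σ * (‖a (n + 1)‖ * σ ^ (n + 1)) := by rw [pow_succ]; field_simp
  refine ⟨key, fun z hz => ?_⟩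
  set ρ := (‖z‖ + 1) / 2 with hρ
  have hz0 := norm_nonneg z
  have hρ0 : 0 < ρ := by linarith
  have hρ1 : ρ < 1 := by linarith
  have hzρ : z ∈ Metric.ball (0 : ℂ) ρ := by rw [mem_ball_zero_iff]; linarith
  have hsum0 : Summable fun n => a n * z ^ n := by
    refine Summable.of_norm ((ha ‖z‖ hz0 hz).congr fun n => ?_)
    rw [norm_mul, norm_pow]
  have h1 : Summable fun n : ℕ => ‖a n‖ * (n * ρ ^ (n - 1)) := by
    rw [← summable_nat_add_iff 1]
    refine (key ρ hρ0.le hρ1).congr fun n => ?_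
    have hn : ‖(n : ℂ) + 1‖ = (n : ℝ) + 1 := by
      have := Complex.norm_natCast (n + 1)
      push_cast at this; exact this
    rw [norm_mul, hn]; push_cast; ring
  have := hasDerivAt_tsum_of_isPreconnected (g := fun n z => a n * z ^ n)
    (g' := fun n z => a n * (n * z ^ (n - 1))) h1 Metric.isOpen_ball
    (convex_ball (0 : ℂ) ρ).isPreconnected
    (fun n y _ => (hasDerivAt_pow n y).const_mul (a n))
    (fun n y hy => by
      rw [mem_ball_zero_iff] at hy
      rw [norm_mul, norm_mul, norm_pow, Complex.norm_natCast]
      gcongr) hzρ hsum0 hzρ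
  convert! this using 1
  have hs : Summable fun n : ℕ => a n * (n * z ^ (n - 1)) := by
    refine Summable.of_norm_bounded h1 fun n => ?_
    rw [mem_ball_zero_iff] at hzρ
    rw [norm_mul, norm_mul, norm_pow, Complex.norm_natCast]
    gcongr
  rw [hs.tsum_eq_zero_add]
  simp only [Nat.cast_zero, zero_mul, mul_zero, zero_add]
  refine tsum_congr fun n => ?_
  push_cast; ring

/-- Taylor coefficients at `0` of the solution of `u″ = -Q u` with `u 0 = x`, `u′ 0 = y`,
where `Q` has Taylor coefficients `c`. -/
noncomputable def linearODECoeff (c : ℕ → ℂ) (x y : ℂ) : ℕ → ℂ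
  | 0 => x
  | 1 => y
  | n + 2 => -(∑ k : Fin (n + 1), c (n - k) * linearODECoeff c x y k) / ((n + 1) * (n + 2))
decreasing_by omega

lemma linearODECoeff_add_two (c : ℕ → ℂ) (x y : ℂ) (n : ℕ) :
    ((n : ℂ) + 1) * (((n : ℂ) + 1 + 1) * linearODECoeff c x y (n + 2)) =
      -∑ k ∈ Finset.range (n + 1), linearODECoeff c x y k * c (n - k) := by
  have h1 : (n : ℂ) + 1 ≠ 0 := by exact_mod_cast n.succ_ne_zero
  have h2 : (n : ℂ) + 2 ≠ 0 := by exact_mod_cast (n + 1).succ_ne_zero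
  rw [linearODECoeff, Finset.sum_range]
  simp only [mul_comm (c _)]
  field_simp
  ring

lemma summable_linearODECoeff {c : ℕ → ℂ}
    (hc : ∀ ρ : ℝ, 0 ≤ ρ → ρ < 1 → Summable fun n => ‖c n‖ * ρ ^ n) (x y : ℂ)
    (ρ : ℝ) (h0 : 0 ≤ ρ) (h1 : ρ < 1) :
    Summable fun n => ‖linearODECoeff c x y n‖ * ρ ^ n := by
  set u := linearODECoeff c x y with hu
  set σ := (ρ + 1) / 2 with hσ
  have hσ0 : 0 < σ := by linarith
  have hσ1 : σ < 1 := by linarith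
  have hcσ := hc σ hσ0.le hσ1
  set M := ∑' n, ‖c n‖ * σ ^ n
  obtain ⟨N, hN⟩ := exists_nat_ge M
  set A := ∑ k ∈ Finset.range (N + 2), ‖u k‖ * σ ^ k with hA
  have hA0 : 0 ≤ A := Finset.sum_nonneg fun _ _ => by positivity
  have bound : ∀ n, ‖u n‖ * σ ^ n ≤ A := by
    intro n
    induction n using Nat.strong_induction_on with
    | _ n ih =>
    by_cases hn : n < N + 2
    · exact Finset.single_le_sum (f := fun k => ‖u k‖ * σ ^ k) (fun _ _ => by positivity)
        (Finset.mem_range.2 hn)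
    · obtain ⟨m, rfl⟩ : ∃ m, n = m + 2 := ⟨n - 2, by omega⟩
      have hrec := congrArg norm (linearODECoeff_add_two c x y m)
      have hm1 : ‖(m : ℂ) + 1‖ = (m : ℝ) + 1 := by
        have := Complex.norm_natCast (m + 1)
        push_cast at this; exact this
      have hm2 : ‖(m : ℂ) + 1 + 1‖ = (m : ℝ) + 1 + 1 := by
        have := Complex.norm_natCast (m + 1 + 1)
        push_cast at this; exact this
      rw [norm_mul, norm_mul, hm1, hm2, norm_neg, ← hu] at hrec
      have hsum : ‖∑ k ∈ Finset.range (m + 1), u k * c (m - k)‖ * σ ^ m ≤ A * M := by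
        calc ‖∑ k ∈ Finset.range (m + 1), u k * c (m - k)‖ * σ ^ m
            ≤ (∑ k ∈ Finset.range (m + 1), ‖u k * c (m - k)‖) * σ ^ m := by
              gcongr; exact norm_sum_le _ _
          _ = ∑ k ∈ Finset.range (m + 1), (‖u k‖ * σ ^ k) * (‖c (m - k)‖ * σ ^ (m - k)) := by
              rw [Finset.sum_mul]
              refine Finset.sum_congr rfl fun k hk => ?_
              have : σ ^ m = σ ^ k * σ ^ (m - k) := by
                rw [← pow_add]; congr 1; have := Finset.mem_range.1 hk; omega
              rw [this, norm_mul]; ring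
          _ ≤ ∑ k ∈ Finset.range (m + 1), A * (‖c (m - k)‖ * σ ^ (m - k)) := by
              refine Finset.sum_le_sum fun k hk => ?_
              gcongr
              exact ih k (by have := Finset.mem_range.1 hk; omega)
          _ = A * ∑ k ∈ Finset.range (m + 1), ‖c k‖ * σ ^ k := by
              rw [← Finset.mul_sum]
              congr 1
              exact Finset.sum_range_reflect (fun k => ‖c k‖ * σ ^ k) (m + 1)
          _ ≤ A * M := by
              gcongr
              exact hcσ.sum_le_tsum _ fun _ _ => by positivity
      have hmN : M ≤ m := by
        refine hN.trans ?_
        exact_mod_cast (by omega : N ≤ m)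
      have hprod : ((m : ℝ) + 1) * ((m + 1 + 1) * (‖u (m + 2)‖ * σ ^ m)) ≤ A * (m + 1) := by
        calc _ = ‖∑ k ∈ Finset.range (m + 1), u k * c (m - k)‖ * σ ^ m := by rw [← hrec]; ring
          _ ≤ A * M := hsum
          _ ≤ _ := by gcongr; linarith
      have h3 : ((m : ℝ) + 1 + 1) * (‖u (m + 2)‖ * σ ^ m) ≤ A := by
        have : (0 : ℝ) < (m : ℝ) + 1 := by positivity
        nlinarith
      have h4 : ‖u (m + 2)‖ * σ ^ m ≤ A := by
        have : 0 ≤ ‖u (m + 2)‖ * σ ^ m := by positivity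
        have : (0 : ℝ) ≤ (m : ℝ) := by positivity
        nlinarith
      calc ‖u (m + 2)‖ * σ ^ (m + 2) ≤ ‖u (m + 2)‖ * σ ^ m := by
            gcongr ?_ * ?_
            exact pow_le_pow_of_le_one hσ0.le hσ1.le (by omega)
        _ ≤ A := h4
  have hg : Summable fun n : ℕ => A * (ρ / σ) ^ n :=
    (summable_geometric_of_lt_one (by positivity)
      (by rw [div_lt_one hσ0]; linarith)).mul_left A
  refine Summable.of_nonneg_of_le (fun n => by positivity) (fun n => ?_) hg
  calc ‖u n‖ * ρ ^ n = (‖u n‖ * σ ^ n) * (ρ / σ) ^ n := by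
        rw [mul_assoc, ← mul_pow, mul_div_cancel₀ _ hσ0.ne']
    _ ≤ A * (ρ / σ) ^ n := by gcongr; exact bound n

/-- Holomorphic second-order linear initial value problems on the unit disc are solvable. -/
lemma exists_linearODE_solution_unitDisc {Q : ℂ → ℂ}
    (hQ : DifferentiableOn ℂ Q (Metric.ball 0 1)) (x y : ℂ) :
    ∃ v v' : ℂ → ℂ, v 0 = x ∧ v' 0 = y ∧ ∀ z : ℂ, ‖z‖ < 1 →
      HasDerivAt v (v' z) z ∧ HasDerivAt v' (-(Q z) * v z) z := by
  set c : ℕ → ℂ := fun n => (n.factorial : ℂ)⁻¹ * iteratedDeriv n Q 0 with hc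
  have hQs : ∀ z : ℂ, ‖z‖ < 1 → HasSum (fun n => c n * z ^ n) (Q z) := by
    intro z hz
    have := Complex.hasSum_taylorSeries_on_ball hQ (z := z) (by simpa using hz)
    convert! this using 2 with n
    simp only [hc, smul_eq_mul, sub_zero]
    ring
  have hcs : ∀ ρ : ℝ, 0 ≤ ρ → ρ < 1 → Summable fun n => ‖c n‖ * ρ ^ n := by
    intro ρ h0 h1
    have := (hQs ρ (by rwa [Complex.norm_real, Real.norm_of_nonneg h0])).summable.norm
    refine this.congr fun n => ?_
    rw [norm_mul, norm_pow, Complex.norm_real, Real.norm_of_nonneg h0]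
  set u := linearODECoeff c x y with hu
  have hus := summable_linearODECoeff hcs x y
  obtain ⟨hus', hd⟩ := hasDerivAt_tsum_mul_pow hus
  obtain ⟨-, hd'⟩ := hasDerivAt_tsum_mul_pow hus'
  refine ⟨_, _, ?_, ?_, fun z hz => ⟨hd z hz, ?_⟩⟩
  · rw [tsum_eq_single 0 (fun n hn => by simp [hn])]
    simp [linearODECoeff]
  · rw [tsum_eq_single 0 (fun n hn => by simp [hn])]
    simp [linearODECoeff]
  · convert! hd' z hz using 1
    have e1 : Summable fun n => ‖c n * z ^ n‖ := (hQs z hz).summable.norm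
    have e2 : Summable fun n => ‖u n * z ^ n‖ := by
      refine (hus ‖z‖ (norm_nonneg z) hz).congr fun n => ?_
      rw [norm_mul, norm_pow]
    rw [← (hQs z hz).tsum_eq, neg_mul, mul_comm,
      tsum_mul_tsum_eq_tsum_sum_range_of_summable_norm e2 e1, ← tsum_neg]
    refine tsum_congr fun n => ?_
    have := linearODECoeff_add_two c x y n
    push_cast
    rw [this, neg_mul, Finset.sum_mul]
    congr 1
    refine Finset.sum_congr rfl fun k hk => ?_
    have : z ^ n = z ^ k * z ^ (n - k) := by
      rw [← pow_add]; congr 1; have := Finset.mem_range.1 hk; omega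
    rw [this]; ring

/-- Sturm comparison with `φ″ = -φ / (1 - x²)²`, `φ = √(1 - x²)`. -/
lemma ne_zero_of_sturm_comparison {v v' q : ℝ → ℂ} {s ρ : ℝ} (hρ0 : 0 < ρ) (hρ1 : ρ < 1)
    (hs : s < 1) (hv : ∀ x ∈ Set.Icc 0 ρ, HasDerivAt v (v' x) x)
    (hv' : ∀ x ∈ Set.Icc 0 ρ, HasDerivAt v' (-(q x) * v x) x)
    (hq : ∀ x ∈ Set.Icc 0 ρ, ‖q x‖ ≤ s / (1 - x ^ 2) ^ 2)
    (h0 : v 0 = 0 ∨ v' 0 = 0) (hne : v 0 ≠ 0 ∨ v' 0 ≠ 0) : v ρ ≠ 0 := by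
  intro hvρ
  set F : ℝ → ℝ := fun x => ((v x).re * (v' x).re + (v x).im * (v' x).im) +
    x / (1 - x ^ 2) * ((v x).re ^ 2 + (v x).im ^ 2) with hF
  have hpos : ∀ x ∈ Set.Icc 0 ρ, 0 < 1 - x ^ 2 := fun x hx => by
    have := hx.1; have := hx.2; nlinarith
  set F' : ℝ → ℝ := fun x => (((v' x).re + x / (1 - x ^ 2) * (v x).re) ^ 2 +
      ((v' x).im + x / (1 - x ^ 2) * (v x).im) ^ 2) +
      (1 / (1 - x ^ 2) ^ 2 - (q x).re) * ((v x).re ^ 2 + (v x).im ^ 2) with hF'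
  have hre : ∀ {f : ℝ → ℂ} {f' : ℂ} {x : ℝ}, HasDerivAt f f' x →
      HasDerivAt (fun x => (f x).re) f'.re x := fun h =>
    Complex.reCLM.hasFDerivAt.comp_hasDerivAt _ h
  have him : ∀ {f : ℝ → ℂ} {f' : ℂ} {x : ℝ}, HasDerivAt f f' x →
      HasDerivAt (fun x => (f x).im) f'.im x := fun h =>
    Complex.imCLM.hasFDerivAt.comp_hasDerivAt _ h
  have hFd : ∀ x ∈ Set.Icc 0 ρ, HasDerivAt F (F' x) x := by
    intro x hx
    have hp := (hpos x hx).ne'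
    have d1 := hre (hv x hx)
    have d2 := him (hv x hx)
    have d3 := hre (hv' x hx)
    have d4 := him (hv' x hx)
    have d5 : HasDerivAt (fun x : ℝ => x / (1 - x ^ 2)) ((1 + x ^ 2) / (1 - x ^ 2) ^ 2) x := by
      convert! (hasDerivAt_id x).div ((hasDerivAt_pow 2 x).const_sub 1) hp using 1
      simp only [id_eq]; push_cast; ring
    convert! ((d1.mul d3).add (d2.mul d4)).add (d5.mul ((d1.pow 2).add (d2.pow 2))) using 1
    simp only [hF', Complex.mul_re, Complex.mul_im, Complex.neg_re, Complex.neg_im,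
      Pi.add_apply, Pi.pow_apply]
    field_simp
    ring
  have hlow : ∀ x ∈ Set.Icc 0 ρ,
      (1 - s) / (1 - x ^ 2) ^ 2 * ((v x).re ^ 2 + (v x).im ^ 2) ≤ F' x := by
    intro x hx
    have h1 : (q x).re ≤ s / (1 - x ^ 2) ^ 2 := (Complex.re_le_norm _).trans (hq x hx)
    have h2 : (1 - s) / (1 - x ^ 2) ^ 2 ≤ 1 / (1 - x ^ 2) ^ 2 - (q x).re := by
      rw [sub_div]; linarith
    have h3 := mul_le_mul_of_nonneg_right h2
      (by positivity : 0 ≤ (v x).re ^ 2 + (v x).im ^ 2)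
    have h4 : 0 ≤ ((v' x).re + x / (1 - x ^ 2) * (v x).re) ^ 2 +
      ((v' x).im + x / (1 - x ^ 2) * (v x).im) ^ 2 := by positivity
    simp only [hF']; linarith
  have hcoef : ∀ x ∈ Set.Icc 0 ρ, 0 < (1 - s) / (1 - x ^ 2) ^ 2 := fun x hx =>
    div_pos (by linarith) (pow_pos (hpos x hx) 2)
  have hmono : MonotoneOn F (Set.Icc 0 ρ) := by
    refine monotoneOn_of_deriv_nonneg (convex_Icc 0 ρ)
      (fun x hx => (hFd x hx).continuousAt.continuousWithinAt)
      (fun x hx => (hFd x (interior_subset hx)).differentiableAt.differentiableWithinAt)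
      fun x hx => ?_
    have hx' := interior_subset hx
    rw [(hFd x hx').deriv]
    exact (mul_nonneg (hcoef x hx').le (by positivity)).trans (hlow x hx')
  have hF0 : F 0 = 0 := by
    rcases h0 with h | h <;> simp [hF, h]
  have hFρ : F ρ = 0 := by simp [hF, hvρ]
  have hFz : ∀ x ∈ Set.Icc 0 ρ, F x = 0 := fun x hx => le_antisymm
    (hFρ ▸ hmono hx (Set.right_mem_Icc.2 hρ0.le) hx.2)
    (hF0 ▸ hmono (Set.left_mem_Icc.2 hρ0.le) hx hx.1)
  have hvz : ∀ x ∈ Set.Ioo 0 ρ, v x = 0 := by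
    intro x hx
    have hx' := Set.Ioo_subset_Icc_self hx
    have hev : F =ᶠ[nhds x] fun _ => 0 := by
      filter_upwards [Ioo_mem_nhds hx.1 hx.2] with y hy using hFz y (Set.Ioo_subset_Icc_self hy)
    have hz : F' x = 0 := (hFd x hx').unique ((hasDerivAt_const x (0 : ℝ)).congr_of_eventuallyEq hev)
    have h5 := hlow x hx'
    rw [hz] at h5
    have h6 : (v x).re ^ 2 + (v x).im ^ 2 ≤ 0 := by
      by_contra! h
      exact absurd h5 (not_le.2 (mul_pos (hcoef x hx') h))
    apply Complex.ext <;> simp <;> nlinarith [sq_nonneg (v x).re, sq_nonneg (v x).im]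
  have hvz' : ∀ x ∈ Set.Ioo 0 ρ, v' x = 0 := by
    intro x hx
    have hev : v =ᶠ[nhds x] fun _ => 0 := by
      filter_upwards [Ioo_mem_nhds hx.1 hx.2] with y hy using hvz y hy
    exact (hv x (Set.Ioo_subset_Icc_self hx)).unique
      ((hasDerivAt_const x (0 : ℂ)).congr_of_eventuallyEq hev)
  have hlim : ∀ {f f' : ℝ → ℂ}, (∀ x ∈ Set.Icc 0 ρ, HasDerivAt f (f' x) x) →
      (∀ x ∈ Set.Ioo 0 ρ, f x = 0) → f 0 = 0 := by
    intro f f' hf hz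
    have t1 : Filter.Tendsto f (nhdsWithin 0 (Set.Ioi 0)) (nhds (f 0)) :=
      (hf 0 (Set.left_mem_Icc.2 hρ0.le)).continuousAt.tendsto.mono_left nhdsWithin_le_nhds
    have t2 : Filter.Tendsto f (nhdsWithin 0 (Set.Ioi 0)) (nhds 0) := by
      refine tendsto_const_nhds.congr' ?_
      filter_upwards [Ioo_mem_nhdsGT hρ0] with x hx using (hz x hx).symm
    exact tendsto_nhds_unique t1 t2
  rcases hne with h | h
  · exact h (hlim hv hvz)
  · exact h (hlim hv' hvz')

lemma norm_sum_mul_sq_sub_sq_sum_le {ι : Type*} (s : Finset ι) (p : ι → ℝ) (x : ι → ℂ)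
    (hp : ∀ j ∈ s, 0 ≤ p j) (hp1 : ∑ j ∈ s, p j ≤ 1)
    (hx : ∀ j ∈ s, ‖x j‖ ^ 2 = 2 * (x j).re) :
    ‖∑ j ∈ s, (p j : ℂ) * x j ^ 2 - (∑ j ∈ s, (p j : ℂ) * x j) ^ 2‖ ≤ 1 := by
  set m := ∑ j ∈ s, (p j : ℂ) * x j with hm
  have h1 : ∑ j ∈ s, (p j : ℂ) * x j ^ 2 - m ^ 2 =
      ∑ j ∈ s, (p j : ℂ) * (x j - m) ^ 2 + (1 - ((∑ j ∈ s, p j : ℝ) : ℂ)) * m ^ 2 := by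
    have : ∑ j ∈ s, (p j : ℂ) * (x j - m) ^ 2 =
        ∑ j ∈ s, (p j : ℂ) * x j ^ 2 - 2 * m * m + ((∑ j ∈ s, p j : ℝ) : ℂ) * m ^ 2 := by
      conv_rhs => rw [mul_assoc 2 m m]; enter [1, 2, 2, 2]; rw [hm]
      push_cast
      simp only [Finset.mul_sum, Finset.sum_mul]
      rw [← Finset.sum_sub_distrib, ← Finset.sum_add_distrib]
      exact Finset.sum_congr rfl fun j _ => by ring
    rw [this]; ring
  have hmre : m.re = ∑ j ∈ s, p j * (x j).re := by simp [hm]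
  have hmim : m.im = ∑ j ∈ s, p j * (x j).im := by simp [hm]
  have h2 : ∑ j ∈ s, p j * ‖x j - m‖ ^ 2 =
      2 * m.re - 2 * ‖m‖ ^ 2 + (∑ j ∈ s, p j) * ‖m‖ ^ 2 := by
    have e : ∀ j ∈ s, p j * ‖x j - m‖ ^ 2 =
        2 * (p j * (x j).re) - 2 * (m.re * (p j * (x j).re) + m.im * (p j * (x j).im))
          + p j * ‖m‖ ^ 2 := by
      intro j hj
      have := hx j hj
      rw [← Complex.normSq_eq_norm_sq, Complex.normSq_apply] at this ⊢
      rw [← Complex.normSq_eq_norm_sq, Complex.normSq_apply, Complex.sub_re, Complex.sub_im]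
      linear_combination p j * this
    rw [Finset.sum_congr rfl e, Finset.sum_add_distrib, Finset.sum_sub_distrib, ← Finset.mul_sum,
      ← Finset.mul_sum, Finset.sum_add_distrib, ← Finset.mul_sum, ← Finset.mul_sum,
      ← Finset.sum_mul, ← hmre, ← hmim, ← Complex.normSq_eq_norm_sq, Complex.normSq_apply]
  rw [h1]
  calc _ ≤ ∑ j ∈ s, p j * ‖x j - m‖ ^ 2 + (1 - ∑ j ∈ s, p j) * ‖m‖ ^ 2 := by
        refine (norm_add_le _ _).trans (add_le_add ((norm_sum_le _ _).trans ?_) ?_)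
        · refine Finset.sum_le_sum fun j hj => ?_
          rw [norm_mul, norm_pow, Complex.norm_real, Real.norm_of_nonneg (hp j hj)]
        · rw [norm_mul, norm_pow, ← Complex.ofReal_one, ← Complex.ofReal_sub, Complex.norm_real,
            Real.norm_of_nonneg (by linarith)]
    _ = 2 * m.re - ‖m‖ ^ 2 := by rw [h2]; ring
    _ ≤ 1 := by
        rw [← Complex.normSq_eq_norm_sq, Complex.normSq_apply]
        nlinarith [sq_nonneg (m.re - 1), sq_nonneg m.im]

/-- The Nehari bound `‖S‖ ≤ 1 / (2 y²)` for Schwarz–Christoffel maps onto convex polygons. -/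
lemma norm_schwarzChristoffel_schwarzian_le {ι : Type*} (s : Finset ι) (a β : ι → ℝ)
    (hβ : ∀ j ∈ s, 0 ≤ β j) (hsum : ∑ j ∈ s, β j = 2) {t : ℝ} (ht0 : 0 ≤ t) (ht1 : t ≤ 1)
    {z : ℂ} (hz : 0 < z.im) :
    ‖(t : ℂ) * ∑ j ∈ s, (β j : ℂ) / (z - a j) ^ 2 -
      (t : ℂ) ^ 2 / 2 * (∑ j ∈ s, (β j : ℂ) / (z - a j)) ^ 2‖ * z.im ^ 2 ≤ 1 / 2 := by
  have hza : ∀ j, z - a j ≠ 0 := fun j h => by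
    have := congrArg Complex.im h
    simp at this; linarith
  set x : ι → ℂ := fun j => 2 * Complex.I * z.im / (z - a j) with hx
  have key := norm_sum_mul_sq_sub_sq_sum_le s (fun j => t * β j / 2) x
    (fun j hj => by have := hβ j hj; positivity)
    (by rw [← Finset.sum_div, ← Finset.mul_sum, hsum]; linarith)
    (fun j _ => by
      have h1 : (2 * (x j).re) = 2 * (2 * z.im * z.im / Complex.normSq (z - a j)) := by
        simp only [hx, Complex.div_re]
        simp
      have h2 : ‖x j‖ ^ 2 = 4 * z.im ^ 2 / Complex.normSq (z - a j) := by
        simp only [hx, norm_div, norm_mul, div_pow, Complex.normSq_eq_norm_sq, mul_pow]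
        simp
        norm_num
      rw [h1, h2]; ring)
  have e : ∑ j ∈ s, ((t * β j / 2 : ℝ) : ℂ) * x j ^ 2 -
      (∑ j ∈ s, ((t * β j / 2 : ℝ) : ℂ) * x j) ^ 2 =
      (-2 * (z.im : ℂ) ^ 2) * ((t : ℂ) * ∑ j ∈ s, (β j : ℂ) / (z - a j) ^ 2 -
      (t : ℂ) ^ 2 / 2 * (∑ j ∈ s, (β j : ℂ) / (z - a j)) ^ 2) := by
    have e1 : ∑ j ∈ s, ((t * β j / 2 : ℝ) : ℂ) * x j ^ 2 =
        (-2 * (z.im : ℂ) ^ 2) * (t : ℂ) * ∑ j ∈ s, (β j : ℂ) / (z - a j) ^ 2 := by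
      rw [Finset.mul_sum]
      refine Finset.sum_congr rfl fun j _ => ?_
      simp only [hx, div_pow, mul_pow, Complex.I_sq]; push_cast; ring
    have e2 : ∑ j ∈ s, ((t * β j / 2 : ℝ) : ℂ) * x j =
        (Complex.I * z.im * t) * ∑ j ∈ s, (β j : ℂ) / (z - a j) := by
      rw [Finset.mul_sum]
      refine Finset.sum_congr rfl fun j _ => ?_
      simp only [hx]; push_cast; ring
    rw [e1, e2, mul_pow, mul_pow, mul_pow, Complex.I_sq]; ring
  rw [e, norm_mul, norm_mul, norm_neg, norm_pow, Complex.norm_real, Real.norm_of_nonneg hz.le] at key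
  simp at key
  linarith
lemma hasDerivAt_mobius {a b c d z : ℂ} (hz : c * z + d ≠ 0) :
    HasDerivAt (fun z => (a * z + b) / (c * z + d)) ((a * d - b * c) / (c * z + d) ^ 2) z := by
  convert! (((hasDerivAt_id z).const_mul a).add_const b).div
    (((hasDerivAt_id z).const_mul c).add_const d) hz using 1
  simp only [id_eq]; ring

/-- Möbius covariance of second-order linear equations `u″ = A`. -/
lemma hasDerivAt_mobius_pullback {a b c d z A : ℂ} {u u' : ℂ → ℂ} (hz : c * z + d ≠ 0)
    (hu : HasDerivAt u (u' ((a * z + b) / (c * z + d))) ((a * z + b) / (c * z + d)))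
    (hu' : HasDerivAt u' A ((a * z + b) / (c * z + d))) :
    HasDerivAt (fun z => (c * z + d) * u ((a * z + b) / (c * z + d)))
      (c * u ((a * z + b) / (c * z + d)) +
        (a * d - b * c) / (c * z + d) * u' ((a * z + b) / (c * z + d))) z ∧
    HasDerivAt (fun z => c * u ((a * z + b) / (c * z + d)) +
        (a * d - b * c) / (c * z + d) * u' ((a * z + b) / (c * z + d)))
      ((a * d - b * c) ^ 2 / (c * z + d) ^ 3 * A) z := by
  have hT := hasDerivAt_mobius (a := a) (b := b) hz
  have hl : HasDerivAt (fun z => c * z + d) c z := by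
    simpa using ((hasDerivAt_id z).const_mul c).add_const d
  have c1 := HasDerivAt.comp z hu hT
  have c2 := HasDerivAt.comp z hu' hT
  constructor
  · convert! hl.mul c1 using 1
    simp only [Function.comp]
    field_simp
  · convert! (c1.const_mul c).add (((hasDerivAt_const z (a * d - b * c)).div hl hz).mul c2) using 1
    simp only [Function.comp, Pi.div_apply]
    field_simp
    ring

lemma im_halfPlane_mobius {p ζ : ℂ} :
    (((-(starRingEnd ℂ p)) * ζ + p) / ((-1) * ζ + 1)).im =
      p.im * (1 - ‖ζ‖ ^ 2) / ‖(-1) * ζ + 1‖ ^ 2 := by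
  rw [← Complex.normSq_eq_norm_sq, ← Complex.normSq_eq_norm_sq, Complex.div_im,
    ← sub_div]
  congr 1
  simp [Complex.normSq_apply]
  ring

lemma neg_one_mul_add_one_ne_zero {ζ : ℂ} (h : ‖ζ‖ < 1) : (-1) * ζ + 1 ≠ 0 := by
  intro h0
  have : ζ = 1 := by linear_combination -h0
  rw [this] at h; simp at h

/-- Disconjugacy in the half-plane under Nehari's bound: a nontrivial solution of `u″ = -q u`
which vanishes at `p`, or is critical at `p` in the hyperbolic sense, has no other zero. -/
lemma ne_zero_of_nehari_bound {u u' q : ℂ → ℂ} {s : ℝ} (hs : s < 1)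
    (hu : ∀ z : ℂ, 0 < z.im → HasDerivAt u (u' z) z)
    (hu' : ∀ z : ℂ, 0 < z.im → HasDerivAt u' (-(q z) * u z) z)
    (hq : ∀ z : ℂ, 0 < z.im → ‖q z‖ * z.im ^ 2 ≤ s / 4)
    {p z : ℂ} (hp : 0 < p.im) (hz : 0 < z.im) (hzp : z ≠ p)
    (h0 : u p = 0 ∨ 2 * Complex.I * p.im * u' p = u p) (hne : u p ≠ 0 ∨ u' p ≠ 0) :
    u z ≠ 0 := by
  have hzc : z - starRingEnd ℂ p ≠ 0 := fun h => by
    have := congrArg Complex.im h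
    simp at this; linarith
  set D : ℂ := 2 * Complex.I * p.im with hD
  have hD0 : D ≠ 0 := by simp [hD, hp.ne']
  have hDdet : (-(starRingEnd ℂ p)) * 1 - p * (-1) = D := by
    apply Complex.ext <;> simp [hD]; ring
  have hDn : ‖D‖ ^ 2 = 4 * p.im ^ 2 := by
    simp only [hD, norm_mul, Complex.norm_I, Complex.norm_real, mul_pow, Real.norm_eq_abs, sq_abs]
    norm_num
  set ζ : ℂ := (z - p) / (z - starRingEnd ℂ p) with hζ
  have hζ0 : ζ ≠ 0 := div_ne_zero (sub_ne_zero.2 hzp) hzc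
  have hζ1 : ‖ζ‖ < 1 := by
    rw [hζ, norm_div, div_lt_one (norm_pos_iff.2 hzc), ← sq_lt_sq₀ (norm_nonneg _) (norm_nonneg _),
      ← Complex.normSq_eq_norm_sq, ← Complex.normSq_eq_norm_sq, Complex.normSq_apply,
      Complex.normSq_apply]
    simp
    nlinarith [mul_pos hp hz]
  set T : ℂ → ℂ := fun ξ => ((-(starRingEnd ℂ p)) * ξ + p) / ((-1) * ξ + 1) with hT
  have hTζ : T ζ = z := by
    have h1 := neg_one_mul_add_one_ne_zero hζ1
    rw [hT]
    simp only
    rw [div_eq_iff h1, hζ]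
    field_simp
    ring
  set ρ := ‖ζ‖ with hρ
  have hρ0 : 0 < ρ := norm_pos_iff.2 hζ0
  have hρc : (ρ : ℂ) ≠ 0 := by exact_mod_cast hρ0.ne'
  set e : ℂ := ζ / ρ with he
  have he1 : ‖e‖ = 1 := by
    rw [he, norm_div, Complex.norm_real, Real.norm_of_nonneg hρ0.le, div_self hρ0.ne']
  have hxe : ∀ x ∈ Set.Icc 0 ρ, ‖e * (x : ℂ)‖ = x := fun x hx => by
    rw [norm_mul, he1, Complex.norm_real, Real.norm_of_nonneg hx.1, one_mul]
  have him : ∀ ξ : ℂ, ‖ξ‖ < 1 → 0 < (T ξ).im := fun ξ hξ => by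
    simp only [hT]
    rw [im_halfPlane_mobius]
    have h1 := norm_pos_iff.2 (neg_one_mul_add_one_ne_zero hξ)
    have h2 : 0 < 1 - ‖ξ‖ ^ 2 := by nlinarith [norm_nonneg ξ]
    positivity
  set V : ℂ → ℂ := fun ξ => ((-1) * ξ + 1) * u (T ξ) with hV
  set V' : ℂ → ℂ := fun ξ => (-1) * u (T ξ) + D / ((-1) * ξ + 1) * u' (T ξ) with hV'
  set R : ℂ → ℂ := fun ξ => D ^ 2 / ((-1) * ξ + 1) ^ 4 * q (T ξ) with hR
  have hVd : ∀ ξ : ℂ, ‖ξ‖ < 1 → HasDerivAt V (V' ξ) ξ ∧ HasDerivAt V' (-(R ξ) * V ξ) ξ := by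
    intro ξ hξ
    have hn := neg_one_mul_add_one_ne_zero hξ
    have := hasDerivAt_mobius_pullback (a := -(starRingEnd ℂ p)) (b := p) hn
      (hu _ (him ξ hξ)) (hu' _ (him ξ hξ))
    rw [hDdet] at this
    refine ⟨this.1, ?_⟩
    convert! this.2 using 1
    simp only [hR, hV, hT]
    field_simp
  have hRb : ∀ ξ : ℂ, ‖ξ‖ < 1 → ‖R ξ‖ ≤ s / (1 - ‖ξ‖ ^ 2) ^ 2 := by
    intro ξ hξ
    have h1 := norm_pos_iff.2 (neg_one_mul_add_one_ne_zero hξ)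
    have h2 : 0 < 1 - ‖ξ‖ ^ 2 := by nlinarith [norm_nonneg ξ]
    have h3 := hq _ (him ξ hξ)
    have h4 : (T ξ).im = p.im * (1 - ‖ξ‖ ^ 2) / ‖(-1) * ξ + 1‖ ^ 2 := im_halfPlane_mobius
    rw [h4] at h3
    rw [le_div_iff₀ (by positivity)]
    simp only [hR]
    rw [norm_mul, norm_div, norm_pow, norm_pow, hDn]
    calc _ = 4 * (‖q (T ξ)‖ * (p.im * (1 - ‖ξ‖ ^ 2) / ‖(-1) * ξ + 1‖ ^ 2) ^ 2) := by
          field_simp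
      _ ≤ s := by linarith
  have hline : ∀ x : ℝ, HasDerivAt (fun x : ℝ => e * (x : ℂ)) e x := fun x => by
    simpa using (Complex.ofRealCLM.hasDerivAt (x := x)).const_mul e
  have hlt : ∀ x ∈ Set.Icc 0 ρ, ‖e * (x : ℂ)‖ < 1 := fun x hx =>
    (hxe x hx).symm ▸ hx.2.trans_lt hζ1
  have he0 : e ≠ 0 := norm_ne_zero_iff.1 (by rw [he1]; exact one_ne_zero)
  have hT0 : T 0 = p := by simp [hT]
  have main := ne_zero_of_sturm_comparison (v := fun x : ℝ => V (e * x))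
    (v' := fun x : ℝ => e * V' (e * x)) (q := fun x : ℝ => e ^ 2 * R (e * x)) (s := s)
    hρ0 hζ1 hs
    (fun x hx => by
      convert! HasDerivAt.comp x (hVd _ (hlt x hx)).1 (hline x) using 1
      ring)
    (fun x hx => by
      convert! (HasDerivAt.comp x (hVd _ (hlt x hx)).2 (hline x)).const_mul e using 1
      ring)
    (fun x hx => by
      have := hRb _ (hlt x hx)
      rw [hxe x hx] at this
      rwa [norm_mul, norm_pow, he1, one_pow, one_mul])
    (by
      simp only [Complex.ofReal_zero, mul_zero, hV, hV', hT0]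
      rcases h0 with h | h
      · left; simp [h]
      · right; simp [h])
    (by
      simp only [Complex.ofReal_zero, mul_zero, hV, hV', hT0]
      by_cases h : u p = 0
      · right
        have := hne.resolve_left (not_not.2 h)
        simp [h, he0, hD0, this]
      · left; simpa using h)
  have heρ : e * (ρ : ℂ) = ζ := by rw [he]; field_simp
  simp only [heρ, hV, hTζ] at main
  exact right_ne_zero_of_mul main

lemma exists_linearODE_solution_halfPlane {q : ℂ → ℂ}
    (hq : DifferentiableOn ℂ q {z | 0 < z.im}) (x y : ℂ) :
    ∃ u u' : ℂ → ℂ, u Complex.I = x ∧ u' Complex.I = y ∧ ∀ z : ℂ, 0 < z.im →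
      HasDerivAt u (u' z) z ∧ HasDerivAt u' (-(q z) * u z) z := by
  set T : ℂ → ℂ := fun ξ => ((-(starRingEnd ℂ Complex.I)) * ξ + Complex.I) / ((-1) * ξ + 1) with hT
  have him : ∀ ξ : ℂ, ‖ξ‖ < 1 → 0 < (T ξ).im := fun ξ hξ => by
    simp only [hT]
    rw [im_halfPlane_mobius, Complex.I_im]
    have h1 := norm_pos_iff.2 (neg_one_mul_add_one_ne_zero hξ)
    have h2 : 0 < 1 - ‖ξ‖ ^ 2 := by nlinarith [norm_nonneg ξ]
    positivity
  have hQ : DifferentiableOn ℂ (fun ξ => -4 * q (T ξ) / ((-1) * ξ + 1) ^ 4) (Metric.ball 0 1) := by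
    intro ξ hξ
    have hξ' : ‖ξ‖ < 1 := by simpa using hξ
    have hn := neg_one_mul_add_one_ne_zero hξ'
    have hqd : DifferentiableAt ℂ q (T ξ) :=
      hq.differentiableAt ((isOpen_lt continuous_const Complex.continuous_im).mem_nhds (him ξ hξ'))
    have hTd : DifferentiableAt ℂ T ξ := (hasDerivAt_mobius hn).differentiableAt
    have hc : DifferentiableAt ℂ (fun ξ => q (T ξ)) ξ := DifferentiableAt.comp ξ hqd hTd
    have hd : DifferentiableAt ℂ (fun ξ : ℂ => ((-1) * ξ + 1) ^ 4) ξ := by fun_prop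
    exact ((hc.const_mul (-4)).fun_div hd (pow_ne_zero 4 hn)).differentiableWithinAt
  obtain ⟨v, v', hv0, hv'0, hv⟩ := exists_linearODE_solution_unitDisc hQ
    (x / (2 * Complex.I)) (y - x / (2 * Complex.I))
  set C : ℂ → ℂ := fun z => (1 * z + -Complex.I) / (1 * z + Complex.I) with hC
  refine ⟨fun z => (1 * z + Complex.I) * v (C z), fun z => 1 * v (C z) +
    (1 * Complex.I - -Complex.I * 1) / (1 * z + Complex.I) * v' (C z), ?_, ?_, fun z hz => ?_⟩
  · have : C Complex.I = 0 := by simp [hC]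
    simp only [this, hv0]
    have := Complex.I_ne_zero
    field_simp
    ring
  · have : C Complex.I = 0 := by simp [hC]
    simp only [this, hv0, hv'0]
    have := Complex.I_ne_zero
    field_simp
    ring
  · have hzi : 1 * z + Complex.I ≠ 0 := fun h => by
      have := congrArg Complex.im h
      simp at this; linarith
    have hzi' : z + Complex.I ≠ 0 := by rwa [one_mul] at hzi
    have hC1 : ‖C z‖ < 1 := by
      simp only [hC]
      rw [norm_div, div_lt_one (norm_pos_iff.2 hzi),
        ← sq_lt_sq₀ (norm_nonneg _) (norm_nonneg _),
        ← Complex.normSq_eq_norm_sq, ← Complex.normSq_eq_norm_sq, Complex.normSq_apply,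
        Complex.normSq_apply]
      simp
      nlinarith
    obtain ⟨h1, h2⟩ := hv _ hC1
    obtain ⟨h3, h4⟩ := hasDerivAt_mobius_pullback (a := 1) (b := -Complex.I) hzi h1 h2
    refine ⟨h3, ?_⟩
    convert! h4 using 1
    have e1 : (-1) * C z + 1 = 2 * Complex.I / (1 * z + Complex.I) := by
      simp only [hC]; field_simp [hzi']; ring
    have e2 : T (C z) = z := by
      have hn := neg_one_mul_add_one_ne_zero hC1
      simp only [hT]
      rw [div_eq_iff hn, e1, Complex.conj_I]
      simp only [hC]
      field_simp [hzi']
      ring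
    have e3 : (1 * Complex.I - -Complex.I * 1) ^ 2 = -4 := by
      ring_nf; simp [Complex.I_sq]
    have e4 : (2 * Complex.I) ^ 4 = 16 := by rw [mul_pow, Complex.I_pow_four]; norm_num
    simp only
    rw [e2, e1, e3, div_pow, e4]
    field_simp
    ring

/-- Nehari's univalence criterion in the upper half-plane, with strict constant. -/
theorem exists_injOn_schwarzianDeriv_eq {S : ℂ → ℂ} {s : ℝ} (hs : s < 1)
    (hS : DifferentiableOn ℂ S {z | 0 < z.im})
    (hb : ∀ z : ℂ, 0 < z.im → ‖S z‖ * z.im ^ 2 ≤ s / 2) :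
    ∃ w : ℂ → ℂ,
      (∀ z ∈ {z : ℂ | 0 < z.im}, DifferentiableAt ℂ w z) ∧
      (∀ z ∈ {z : ℂ | 0 < z.im}, deriv w z ≠ 0) ∧
      Set.InjOn w {z : ℂ | 0 < z.im} ∧
      ∀ z ∈ {z : ℂ | 0 < z.im}, schwarzianDeriv w z = S z := by
  have hUo : IsOpen {z : ℂ | 0 < z.im} := isOpen_lt continuous_const Complex.continuous_im
  have hUc : IsPreconnected {z : ℂ | 0 < z.im} := (convex_halfSpace_im_gt 0).isPreconnected
  set q : ℂ → ℂ := fun z => S z / 2 with hq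
  have hqd : DifferentiableOn ℂ q {z | 0 < z.im} := hS.div_const 2
  have hqb : ∀ z : ℂ, 0 < z.im → ‖q z‖ * z.im ^ 2 ≤ s / 4 := fun z hz => by
    have := hb z hz
    have e : ‖q z‖ = ‖S z‖ / 2 := by simp [hq]
    rw [e]; linarith
  obtain ⟨f, f', hf0, hf'0, hf⟩ := exists_linearODE_solution_halfPlane hqd 0 1
  obtain ⟨g, g', hg0, hg'0, hg⟩ := exists_linearODE_solution_halfPlane hqd (2 * Complex.I) 1
  have hI : 0 < Complex.I.im := by simp
  have h2I : 2 * Complex.I ≠ 0 := by simp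
  have hg_ne : ∀ z : ℂ, 0 < z.im → g z ≠ 0 := by
    intro z hz
    by_cases hzI : z = Complex.I
    · rw [hzI, hg0]; exact h2I
    · exact ne_zero_of_nehari_bound hs (fun z hz => (hg z hz).1) (fun z hz => (hg z hz).2) hqb
        hI hz hzI (Or.inr (by rw [hg0, hg'0]; simp)) (Or.inl (by rw [hg0]; exact h2I))
  have hW : ∀ z : ℂ, 0 < z.im → f' z * g z - f z * g' z = 2 * Complex.I := by
    intro z hz
    have hd : ∀ z : ℂ, 0 < z.im → HasDerivAt (fun z => f' z * g z - f z * g' z) 0 z := by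
      intro z hz
      convert! ((hf z hz).2.mul (hg z hz).1).sub ((hf z hz).1.mul (hg z hz).2) using 1
      ring
    have := hUo.is_const_of_deriv_eq_zero hUc
      (fun z hz => (hd z hz).differentiableAt.differentiableWithinAt)
      (fun z hz => (hd z hz).deriv) hz hI
    rw [this, hf0, hf'0, hg0]; ring
  have hw : ∀ z : ℂ, 0 < z.im →
      HasDerivAt (fun z => f z / g z) (2 * Complex.I / g z ^ 2) z := by
    intro z hz
    convert! (hf z hz).1.div (hg z hz).1 (hg_ne z hz) using 1
    rw [hW z hz]
  have hev : ∀ {h k : ℂ → ℂ} {z : ℂ}, 0 < z.im → (∀ z : ℂ, 0 < z.im → h z = k z) →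
      h =ᶠ[nhds z] k := fun hz hk => by
    filter_upwards [hUo.mem_nhds hz] with y hy using hk y hy
  refine ⟨fun z => f z / g z, fun z hz => (hw z hz).differentiableAt, fun z hz => ?_, ?_, ?_⟩
  · rw [(hw z hz).deriv]
    exact div_ne_zero h2I (pow_ne_zero 2 (hg_ne z hz))
  · intro z₁ hz₁ z₂ hz₂ h
    by_contra hne
    set c := f z₁ / g z₁ with hc
    have hz1 : f z₁ - c * g z₁ = 0 := by
      rw [hc, div_mul_cancel₀ _ (hg_ne z₁ hz₁), sub_self]
    have hz2 : f z₂ - c * g z₂ = 0 := by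
      have : c = f z₂ / g z₂ := h
      rw [this, div_mul_cancel₀ _ (hg_ne z₂ hz₂), sub_self]
    have hd1 : f' z₁ - c * g' z₁ ≠ 0 := by
      intro h0
      have := hW z₁ hz₁
      exact h2I (by linear_combination -this + g z₁ * h0 - g' z₁ * hz1)
    exact ne_zero_of_nehari_bound (u := fun z => f z - c * g z) (u' := fun z => f' z - c * g' z)
      hs (fun z hz => (hf z hz).1.sub ((hg z hz).1.const_mul c))
      (fun z hz => by
        convert! (hf z hz).2.sub ((hg z hz).2.const_mul c) using 1
        ring) hqb hz₁ hz₂ (Ne.symm hne) (Or.inl hz1) (Or.inr hd1) hz2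
  · intro z hz
    have hw2 : ∀ z : ℂ, 0 < z.im →
        deriv (deriv fun z => f z / g z) z / deriv (fun z => f z / g z) z = -2 * (g' z / g z) := by
      intro z hz
      have hgz := hg_ne z hz
      have e1 : deriv (fun z => f z / g z) =ᶠ[nhds z] fun z => 2 * Complex.I / g z ^ 2 :=
        hev hz fun z hz => (hw z hz).deriv
      have e2 : HasDerivAt (fun z => 2 * Complex.I / g z ^ 2)
          (-(4 * Complex.I) * g' z / g z ^ 3) z := by
        convert! (hasDerivAt_const z (2 * Complex.I)).div ((hg z hz).1.pow 2)
          (pow_ne_zero 2 hgz) using 1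
        simp only [Pi.pow_apply]
        field_simp
        push_cast
        ring
      rw [e1.deriv_eq, e2.deriv, e1.eq_of_nhds]
      field_simp
      ring
    have hgz := hg_ne z hz
    have e3 : HasDerivAt (fun z => -2 * (g' z / g z)) (S z + 2 * (g' z / g z) ^ 2) z := by
      convert! ((hg z hz).2.div (hg z hz).1 hgz).const_mul (-2) using 1
      simp only [hq]
      field_simp
      ring
    rw [schwarzianDeriv, (hev hz hw2).deriv_eq, e3.deriv, hw2 z hz]
    ring

/-- For `0 < r < r₀` the Schwarzian `S_{f*,r} = r·b′ − (r²/2)·b²` is the Schwarzian of a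
function holomorphic and univalent in the upper half-plane. -/
theorem univalence_rescaled_family
    (n : ℕ) (hn : 3 ≤ n) (a : Fin n → ℝ) (ha : StrictMono a)
    (α : Fin n → ℝ) (hα : ∀ j, 0 < α j ∧ α j < 1)
    (hsum : ∑ j, α j = (n : ℝ) - 2)
    (b : ℂ → ℂ)
    (hb : b = fun z : ℂ => ∑ j, ((α j : ℂ) - 1) / (z - (a j : ℂ)))
    (r₀ : ℝ) (hr₀pos : 0 < r₀)
    (hroot : (1 / 2) * (∑ j, (α j - 1) ^ 2
        + ∑ p ∈ Finset.univ.filter (fun p : Fin n × Fin n => p.1 < p.2),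
            (α p.1 - 1) * (α p.2 - 1)) * r₀ ^ 2
      - (∑ j, (α j - 1)) * r₀ - 2 = 0)
    (r : ℝ) (hr : 0 < r) (hrr₀ : r < r₀) :
    ∃ w : ℂ → ℂ,
      (∀ z ∈ {z : ℂ | 0 < z.im}, DifferentiableAt ℂ w z) ∧
      (∀ z ∈ {z : ℂ | 0 < z.im}, deriv w z ≠ 0) ∧
      Set.InjOn w {z : ℂ | 0 < z.im} ∧
      ∀ z ∈ {z : ℂ | 0 < z.im},
        schwarzianDeriv w z = (r : ℂ) * ((r₀ : ℂ) * deriv b z - ((r₀ : ℂ) ^ 2 / 2) * (b z) ^ 2) := by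

  set β : Fin n → ℝ := fun j => 1 - α j with hβ
  have hβ0 : ∀ j, 0 ≤ β j := fun j => by have := (hα j).2; simp only [hβ]; linarith
  have hβs : ∑ j, β j = 2 := by
    simp only [hβ]
    rw [Finset.sum_sub_distrib, hsum]; simp
  have hr₀1 : r₀ ≤ 1 := by
    have h1 : ∑ j, (α j - 1) = -2 := by
      rw [← hβs, ← Finset.sum_neg_distrib]
      exact Finset.sum_congr rfl fun j _ => by simp [hβ]
    have h2 : 0 ≤ ∑ j, (α j - 1) ^ 2 + ∑ p ∈ Finset.univ.filter
        (fun p : Fin n × Fin n => p.1 < p.2), (α p.1 - 1) * (α p.2 - 1) :=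
      add_nonneg (Finset.sum_nonneg fun _ _ => sq_nonneg _) (Finset.sum_nonneg fun p _ =>
        mul_nonneg_of_nonpos_of_nonpos (by linarith [(hα p.1).2]) (by linarith [(hα p.2).2]))
    have h3 := mul_nonneg h2 (sq_nonneg r₀)
    rw [h1] at hroot
    linarith
  have hza : ∀ z : ℂ, 0 < z.im → ∀ j, z - (a j : ℂ) ≠ 0 := fun z hz j h => by
    have := congrArg Complex.im h
    simp at this; linarith
  have hbz : ∀ z, b z = -∑ j, (β j : ℂ) / (z - a j) := fun z => by
    rw [hb, ← Finset.sum_neg_distrib]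
    refine Finset.sum_congr rfl fun j _ => ?_
    simp only [hβ]; push_cast; ring
  have hbd : ∀ z : ℂ, 0 < z.im → HasDerivAt b (∑ j, (β j : ℂ) / (z - a j) ^ 2) z := by
    intro z hz
    rw [hb]
    refine HasDerivAt.fun_sum fun j _ => ?_
    convert! (hasDerivAt_const z ((α j : ℂ) - 1)).div ((hasDerivAt_id z).sub_const (a j : ℂ))
      (hza z hz j) using 1
    simp only [hβ, id_eq]; push_cast; ring
  set S : ℂ → ℂ := fun z => (r : ℂ) * ((r₀ : ℂ) * (∑ j, (β j : ℂ) / (z - a j) ^ 2) -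
    ((r₀ : ℂ) ^ 2 / 2) * (∑ j, (β j : ℂ) / (z - a j)) ^ 2) with hS
  have hSd : DifferentiableOn ℂ S {z | 0 < z.im} := by
    intro z hz
    refine DifferentiableAt.differentiableWithinAt ?_
    have d1 : ∀ j, DifferentiableAt ℂ (fun z => (β j : ℂ) / (z - a j)) z := fun j =>
      (differentiableAt_const _).div (by fun_prop) (hza z hz j)
    have d2 : ∀ j, DifferentiableAt ℂ (fun z => (β j : ℂ) / (z - a j) ^ 2) z := fun j =>
      (differentiableAt_const _).div (by fun_prop) (pow_ne_zero _ (hza z hz j))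
    fun_prop
  have hSb : ∀ z : ℂ, 0 < z.im → ‖S z‖ * z.im ^ 2 ≤ r / 2 := by
    intro z hz
    have := norm_schwarzChristoffel_schwarzian_le Finset.univ a β (fun j _ => hβ0 j) hβs
      hr₀pos.le hr₀1 hz
    simp only [hS]
    rw [norm_mul, Complex.norm_real, Real.norm_of_nonneg hr.le, mul_assoc]
    calc _ ≤ r * (1 / 2) := mul_le_mul_of_nonneg_left this hr.le
      _ = r / 2 := by ring
  obtain ⟨w, h1, h2, h3, h4⟩ :=
    exists_injOn_schwarzianDeriv_eq (hrr₀.trans_le hr₀1) hSd hSb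
  refine ⟨w, h1, h2, h3, fun z hz => ?_⟩
  rw [h4 z hz, (hbd z hz).deriv, hbz z, neg_sq]
end
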